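/- For every k ≥ 1, the multigraph P_k = P + k·M_0 + (k−1)·(M_1 + M_3 + M_4) is 4k-edge-connected: for every nonempty proper subset X of the vertices, the number of edges (with multiplicity) with exactly one endpoint in X is at least 4k. -/

import Mathlib

/-- The edge multiset of the Petersen graph on `Fin 10`: vertices `0,…,4` form
the outer 5-cycle (these are `v₁,…,v₅`), vertex `i+5` is the inner vertex `uᵢ`
joined to `vᵢ` by a spoke, and the inner vertices form a pentagram. -/
def petersenEdges : Multiset (Sym2 (Fin 10)) :=
  {s(0,1), s(1,2), s(2,3), s(3,4), s(4,0),
   s(0,5), s(1,6), s(2,7), s(3,8), s(4,9),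
   s(5,7), s(7,9), s(9,6), s(6,8), s(8,5)}

/-- The spoke perfect matching `M₀ = {uᵢvᵢ}`. -/
def M0 : Multiset (Sym2 (Fin 10)) := {s(0,5), s(1,6), s(2,7), s(3,8), s(4,9)}

/-- `M₁`: the unique perfect matching other than `M₀` containing the spoke `u₁v₁`. -/
def M1 : Multiset (Sym2 (Fin 10)) := {s(1,6), s(2,3), s(0,4), s(7,9), s(5,8)}

/-- `M₃`: the rotation of `M₁` containing the spoke `u₃v₃`. -/
def M3 : Multiset (Sym2 (Fin 10)) := {s(3,8), s(0,4), s(1,2), s(6,9), s(5,7)}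

/-- `M₄`: the rotation of `M₁` containing the spoke `u₄v₄`. -/
def M4 : Multiset (Sym2 (Fin 10)) := {s(4,9), s(0,1), s(2,3), s(5,7), s(6,8)}

/-- The edge multiset of the multigraph `P_k = P + k·M₀ + (k−1)·(M₁+M₃+M₄)`. -/
def PkEdges (k : ℕ) : Multiset (Sym2 (Fin 10)) :=
  petersenEdges + k • M0 + (k - 1) • (M1 + M3 + M4)

/-- Whether the endpoints of an edge get different values under `χ`. -/
def Sym2.separatedBy {α : Type*} (χ : α → Bool) : Sym2 α → Bool :=
  Sym2.lift ⟨fun a b => xor (χ a) (χ b), fun _ _ => Bool.xor_comm _ _⟩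

/-- The number of edges of `E`, with multiplicity, whose endpoints get different values under
`χ`. -/
def cutSize {α : Type*} (χ : α → Bool) (E : Multiset (Sym2 α)) : ℕ :=
  E.countP fun e => e.separatedBy χ

theorem Sym2.exists_eq_mk_mem_notMem_iff {α : Type*} [DecidableEq α] (X : Finset α) (e : Sym2 α) :
    (∃ a ∈ X, ∃ b, b ∉ X ∧ e = s(a, b)) ↔ e.separatedBy (fun v => decide (v ∈ X)) := by
  induction e with
  | _ x y =>
    simp only [Sym2.separatedBy, Sym2.lift_mk, Sym2.eq_iff, bne_iff_ne, ne_eq, decide_eq_decide]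
    constructor
    · rintro ⟨a, ha, b, hb, ⟨rfl, rfl⟩ | ⟨rfl, rfl⟩⟩ <;> tauto
    · intro h
      by_cases hx : x ∈ X
      · exact ⟨x, hx, y, by tauto, by tauto⟩
      · exact ⟨y, by tauto, x, hx, by tauto⟩

theorem card_filter_eq_cutSize (X : Finset (Fin 10)) (E : Multiset (Sym2 (Fin 10))) :
    (E.filter fun e => ∃ a ∈ X, ∃ b, b ∉ X ∧ e = s(a, b)).card =
      cutSize (fun v => decide (v ∈ X)) E := by
  rw [cutSize, Multiset.countP_eq_card_filter,
    Multiset.filter_congr fun e _ => Sym2.exists_eq_mk_mem_notMem_iff X e]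

theorem cutSize_PkEdges (k : ℕ) (χ : Fin 10 → Bool) :
    cutSize χ (PkEdges k) = cutSize χ petersenEdges + k * cutSize χ M0
      + (k - 1) * (cutSize χ M1 + cutSize χ M3 + cutSize χ M4) := by
  simp only [cutSize, PkEdges, Multiset.countP_add, Multiset.countP_nsmul]

theorem four_le_cutSize_cons : ∀ a b c d e f g h i j : Bool,
    (a || b || c || d || e || f || g || h || i || j) →
    !(a && b && c && d && e && f && g && h && i && j) →
    4 ≤ cutSize ![a, b, c, d, e, f, g, h, i, j] petersenEdges +
        cutSize ![a, b, c, d, e, f, g, h, i, j] M0 ∧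
      4 ≤ cutSize ![a, b, c, d, e, f, g, h, i, j] M0 +
        cutSize ![a, b, c, d, e, f, g, h, i, j] M1 +
        cutSize ![a, b, c, d, e, f, g, h, i, j] M3 +
        cutSize ![a, b, c, d, e, f, g, h, i, j] M4 := by
  decide +kernel

/-- The two inequalities say that the cut bound holds at `k = 1`, and that passing from `k` to
`k + 1` adds at least four edges to every cut. -/
theorem four_le_cutSize (χ : Fin 10 → Bool) (htrue : ∃ v, χ v = true) (hfalse : ∃ v, χ v = false) :
    4 ≤ cutSize χ petersenEdges + cutSize χ M0 ∧
      4 ≤ cutSize χ M0 + cutSize χ M1 + cutSize χ M3 + cutSize χ M4 := by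
  have hχ : χ = ![χ 0, χ 1, χ 2, χ 3, χ 4, χ 5, χ 6, χ 7, χ 8, χ 9] := by
    ext v
    fin_cases v <;> rfl
  rw [hχ]
  clear hχ
  apply four_le_cutSize_cons
  · obtain ⟨v, hv⟩ := htrue
    fin_cases v <;> simp_all
  · obtain ⟨v, hv⟩ := hfalse
    fin_cases v <;> simp_all

/-- For every `k ≥ 1`, the multigraph `P_k = P + k·M₀ + (k−1)·(M₁+M₃+M₄)` is
`4k`-edge-connected: every nonempty proper vertex subset `X` has at least
`4k` edges (with multiplicity) with exactly one endpoint in `X`. -/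
theorem Pk_edge_connected (k : ℕ) (hk : 1 ≤ k)
    (X : Finset (Fin 10)) (hne : X.Nonempty) (hproper : X ≠ Finset.univ) :
    4 * k ≤ ((PkEdges k).filter
      (fun e => ∃ a ∈ X, ∃ b, b ∉ X ∧ e = s(a, b))).card := by
  rw [card_filter_eq_cutSize, cutSize_PkEdges]
  obtain ⟨hbase, hstep⟩ := four_le_cutSize (fun v => decide (v ∈ X))
    (by simpa using hne.exists_mem) (by simpa [Finset.eq_univ_iff_forall] using hproper)
  obtain ⟨n, rfl⟩ := Nat.exists_eq_add_of_le' hk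
  rw [Nat.add_sub_cancel]
  nlinarith [Nat.mul_le_mul_left n hstep]
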